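/- Let C = (c_0, …, c_n) be a 1D crease pattern, let α = (c_i, …, c_{i+k}) be a crimpable sequence of C with gap d and k ≥ 3 (so α has at least four creases), and let j with i ≤ j ≤ i+k−1 select an adjacent pair (c_j, c_{j+1}) within α. Then the crease pattern produced by the monocrimp at (c_j, c_{j+1}) is again a strictly increasing sequence, and in it the remaining creases of α, namely c_i, …, c_{j−1}, c_{j+2} − 2d, …, c_{i+k} − 2d, form a crimpable sequence with gap d having two fewer creases (k − 1 creases). -/

import Mathlib

/-- Mountain or valley label for a crease. -/
inductive MV : Type
  | M : MV
  | V : MV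
deriving DecidableEq

/-- `(c 0, c 1, …, c n)` is a 1D crease pattern: a strictly increasing finite
sequence of reals with `n ≥ 1`.  The points `c 1, …, c (n-1)` are its creases,
`c 0` and `c n` its ends. -/
def IsCreasePattern (n : ℕ) (c : ℕ → ℝ) : Prop :=
  1 ≤ n ∧ ∀ i j : ℕ, i < j → j ≤ n → c i < c j

/-- The consecutive creases `(c i, …, c (i+k))` form a crimpable sequence with gap `d`. -/
def IsCrimpable (n : ℕ) (c : ℕ → ℝ) (i k : ℕ) (d : ℝ) : Prop :=
  1 ≤ i ∧ 1 ≤ k ∧ i + k ≤ n - 1 ∧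
  (∀ m : ℕ, i ≤ m → m < i + k → c (m + 1) - c m = d) ∧
  d < c i - c (i - 1) ∧ d < c (i + k + 1) - c (i + k)

/-- Additive offset of the folded-position map on the `j`-th interval:
on `[c j, c (j+1)]` the folded-position map is `x ↦ (-1)^j * x + foldOffset c j`. -/
def foldOffset (c : ℕ → ℝ) : ℕ → ℝ
  | 0 => 0
  | j + 1 => foldOffset c (j) + 2 * (-1 : ℝ) ^ j * c (j + 1)

/-- Folded position of a point `x` belonging to the `j`-th interval `[c j, c (j+1)]`.
This is the unique continuous map equal to the identity on `[c 0, c 1]`, isometric on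
every interval, and reversing direction at every crease. -/
def foldPos (c : ℕ → ℝ) (j : ℕ) (x : ℝ) : ℝ := (-1 : ℝ) ^ j * x + foldOffset c j

/-- Folded position of the crease `c i`. -/
def foldCrease (c : ℕ → ℝ) (i : ℕ) : ℝ := foldPos c i (c i)

/-- `x` lies strictly `lt`-between `a` and `b`. -/
def Between (lt : ℕ → ℕ → Prop) (a b x : ℕ) : Prop :=
  (lt a x ∧ lt x b) ∨ (lt b x ∧ lt x a)

/-- The MV pattern `(C, μ)` is flat-foldable: there is a strict linear order `lt`
("strictly below") on the intervals `I_0, …, I_{n-1}` (indexed `0, …, n-1`) such that: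
(i) for each crease `i`, `I_{i-1}` is below `I_i` iff either `μ i = V` and the folded map
is increasing on `I_{i-1}` (slope `(-1)^(i-1) = 1`), or `μ i = M` and it is decreasing;
(ii) for each crease `i` and each interval `J` whose folded image contains the folded
crease position in its interior, `J` is not strictly between `I_{i-1}` and `I_i`;
(iii) for distinct creases `i, j` folding to the same point, it is not the case that
exactly one of `I_{j-1}`, `I_j` is strictly between `I_{i-1}` and `I_i`. -/
def IsFlatFoldable (n : ℕ) (c : ℕ → ℝ) (μ : ℕ → MV) : Prop :=
  ∃ lt : ℕ → ℕ → Prop,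
    (∀ j, j < n → ¬ lt j j) ∧
    (∀ a b e, lt a b → lt b e → lt a e) ∧
    (∀ a b, a < n → b < n → a ≠ b → lt a b ∨ lt b a) ∧
    (∀ a b, lt a b → a < n ∧ b < n) ∧
    (∀ i, 1 ≤ i → i ≤ n - 1 →
      (lt (i - 1) i ↔ ((μ i = MV.V ∧ Even (i - 1)) ∨ (μ i = MV.M ∧ Odd (i - 1))))) ∧
    (∀ i, 1 ≤ i → i ≤ n - 1 → ∀ j, j < n →
      foldCrease c i ∈
        Set.Ioo (min (foldPos c j (c j)) (foldPos c j (c (j + 1))))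
                (max (foldPos c j (c j)) (foldPos c j (c (j + 1)))) →
      ¬ Between lt (i - 1) i j) ∧
    (∀ i j, 1 ≤ i → i ≤ n - 1 → 1 ≤ j → j ≤ n - 1 → i ≠ j →
      foldCrease c i = foldCrease c j →
      (Between lt (i - 1) i (j - 1) ↔ Between lt (i - 1) i j))

/-- `F` is a forcing set for the MV pattern `(C, μ)`: a set of creases such that the only
flat-foldable assignment agreeing with `μ` on `F` is `μ` itself (on all creases). -/
def IsForcingSet (n : ℕ) (c : ℕ → ℝ) (μ : ℕ → MV) (F : Set ℕ) : Prop :=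
  F ⊆ Set.Icc 1 (n - 1) ∧
  ∀ ν : ℕ → MV, IsFlatFoldable n c ν → (∀ x ∈ F, ν x = μ x) →
    ∀ x, 1 ≤ x → x ≤ n - 1 → ν x = μ x

/-- The crease pattern produced by a monocrimp at the adjacent pair `(c j, c (j+1))`:
it deletes `c j` and `c (j+1)` and translates all later points by `-2 * (c (j+1) - c j)`. -/
def monocrimpPattern (c : ℕ → ℝ) (j : ℕ) : ℕ → ℝ :=
  fun x => if x < j then c x else c (x + 2) - 2 * (c (j + 1) - c j)

/-- Consecutive inequalities up to `n` give a crease pattern. -/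
theorem isCreasePattern_of_lt_succ {n : ℕ} {c : ℕ → ℝ} (hn : 1 ≤ n)
    (h : ∀ m, m < n → c m < c (m + 1)) : IsCreasePattern n c := by
  refine ⟨hn, fun i j hij => ?_⟩
  induction j, hij using Nat.le_induction with
  | base => exact fun hi => h i hi
  | succ j _ ih => exact fun hj => (ih (by lia)).trans (h j hj)

/-- Intervals left of a monocrimp keep their length. -/
theorem monocrimpPattern_gap_of_lt (c : ℕ → ℝ) {j m : ℕ} (h : m + 1 < j) :
    monocrimpPattern c j (m + 1) - monocrimpPattern c j m = c (m + 1) - c m := by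
  simp [monocrimpPattern, h, show m < j by lia]

/-- Intervals right of a monocrimp keep their length. -/
theorem monocrimpPattern_gap_of_le (c : ℕ → ℝ) {j m : ℕ} (h : j ≤ m) :
    monocrimpPattern c j (m + 1) - monocrimpPattern c j m = c (m + 3) - c (m + 2) := by
  simp [monocrimpPattern, show ¬ m + 1 < j by lia, show ¬ m < j by lia]

/-- A monocrimp merges three intervals into one, whose length is the alternating sum. -/
theorem monocrimpPattern_gap_merged (c : ℕ → ℝ) (m : ℕ) :
    monocrimpPattern c (m + 1) (m + 1) - monocrimpPattern c (m + 1) m =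
      (c (m + 1) - c m) - (c (m + 2) - c (m + 1)) + (c (m + 3) - c (m + 2)) := by
  simp only [monocrimpPattern, lt_irrefl, if_false, Nat.lt_succ_self, if_true]
  ring_nf

/-- If `α = (c i, …, c (i+k))` is a crimpable sequence with gap `d` and at least four
creases (`k ≥ 3`), then the crease pattern produced by a monocrimp at an adjacent pair
`(c j, c (j+1))` within `α` is again strictly increasing (a crease pattern with `n - 2`
points), and in it the remaining creases of `α` form a crimpable sequence with gap `d`
having two fewer creases (indices `i, …, i + (k-2)`, i.e. `k - 1` creases). -/
theorem monocrimp_of_crimpable_is_crimpable (n : ℕ) (c : ℕ → ℝ)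
    (hC : IsCreasePattern n c) (i k : ℕ) (d : ℝ)
    (hα : IsCrimpable n c i k d) (hk : 3 ≤ k)
    (j : ℕ) (hj1 : i ≤ j) (hj2 : j + 1 ≤ i + k) :
    IsCreasePattern (n - 2) (monocrimpPattern c j) ∧
    IsCrimpable (n - 2) (monocrimpPattern c j) i (k - 2) d := by
  obtain ⟨-, hmono⟩ := hC
  obtain ⟨hi, -, hn, hgap, hleft, hright⟩ := hα
  obtain ⟨i, rfl⟩ := Nat.exists_eq_add_of_le' hi
  obtain ⟨k, rfl⟩ := Nat.exists_eq_add_of_le' hk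
  rw [Nat.add_sub_cancel] at hleft
  rw [show i + 1 + (k + 3) = i + k + 4 by lia] at hright
  have hpos : ∀ m, m < n → 0 < c (m + 1) - c m := fun m hm =>
    sub_pos.2 (hmono m (m + 1) (by lia) (by lia))
  have hge : ∀ m, i ≤ m → m ≤ i + k + 4 → d ≤ c (m + 1) - c m := by
    intro m h1 h2
    rcases h1.eq_or_lt with rfl | h1
    · exact hleft.le
    rcases h2.eq_or_lt with rfl | h2
    · exact hright.le
    · exact (hgap m h1 (by lia)).ge
  constructor
  · refine isCreasePattern_of_lt_succ (by lia) fun m hm => sub_pos.1 ?_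
    rcases lt_trichotomy (m + 1) j with h | rfl | h
    · rw [monocrimpPattern_gap_of_lt c h]
      exact hpos m (by lia)
    · rw [monocrimpPattern_gap_merged]
      have h1 := hge m (by lia) (by lia)
      have h2 := hgap (m + 1) (by lia) (by lia)
      have h3 := hpos (m + 2) (by lia)
      linarith
    · rw [monocrimpPattern_gap_of_le c (by lia)]
      exact hpos (m + 2) (by lia)
  · refine ⟨hi, by lia, by lia, fun m h1 h2 => ?_, ?_, ?_⟩
    · rcases lt_trichotomy (m + 1) j with h | rfl | h
      · rw [monocrimpPattern_gap_of_lt c h]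
        exact hgap m h1 (by lia)
      · rw [monocrimpPattern_gap_merged, hgap m h1 (by lia), hgap (m + 1) (by lia) (by lia),
          hgap (m + 2) (by lia) (by lia)]
        ring
      · rw [monocrimpPattern_gap_of_le c (by lia)]
        exact hgap (m + 2) (by lia) (by lia)
    · rw [Nat.add_sub_cancel]
      rcases hj1.eq_or_lt with rfl | h
      · rw [monocrimpPattern_gap_merged, hgap (i + 1) (by lia) (by lia),
          hgap (i + 2) (by lia) (by lia)]
        linarith
      · rwa [monocrimpPattern_gap_of_lt c h]
    · rw [show i + 1 + (k + 3 - 2) = i + k + 2 by lia]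
      rcases (show j ≤ i + k + 3 by lia).eq_or_lt with rfl | h
      · rw [monocrimpPattern_gap_merged, hgap (i + k + 2) (by lia) (by lia),
          hgap (i + k + 3) (by lia) (by lia)]
        linarith
      · rwa [monocrimpPattern_gap_of_le c (by lia)]
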